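/- arXiv:2410.23490 — 4 statements merged into one kernel-verified Lean document; each statement's English description precedes it below -/
import Mathlib

section
/- Let (M,η) be an exact contact manifold, H ∈ C^∞(M), and ξ a vector field with Hamiltonian–horizontal decomposition ξ = X_{φ_ξ} + δ_ξ (φ_ξ = −η(ξ), δ_ξ horizontal). Then η([δ_ξ, X_H]) = 0, i.e. [δ_ξ, X_H] is horizontal, and consequently the Hamiltonian–horizontal decomposition of the commutator is [ξ, X_H] = [X_{φ_ξ}, X_H] + [δ_ξ, X_H], with Hamiltonian part [X_{φ_ξ}, X_H] = X_{{φ_ξ, H}_η} and horizontal part [δ_ξ, X_H]. -/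
open scoped BigOperators

/-- Vector fields on the "manifold" whose algebra of smooth functions is `R`,
modeled as ℝ-linear derivations of `R`. -/
abbrev VectorFieldOn (R : Type*) [CommRing R] [Algebra ℝ R] : Type _ := Derivation ℝ R R

/-- The exterior derivative of a 1-form (an `R`-linear functional on vector fields),
via the intrinsic (Koszul) formula `dη(X,Y) = X(η(Y)) - Y(η(X)) - η([X,Y])`. -/
def dForm {R : Type*} [CommRing R] [Algebra ℝ R]
    (η : VectorFieldOn R →ₗ[R] R) (X Y : VectorFieldOn R) : R :=
  X (η Y) - Y (η X) - η ⁅X, Y⁆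

/-- An exact contact manifold of dimension `2n+1`, described through its algebra of
smooth functions `R`: a contact form `eta`, nondegenerate and of maximal rank, with
its Reeb vector field and the contact Hamiltonian vector field assignment `ham`,
each characterized by the usual defining equations (together with uniqueness, which
is what the contact condition `η ∧ (dη)^n ≠ 0` grants). -/
structure ExactContact (R : Type*) [CommRing R] [Algebra ℝ R] where
  n : ℕ
  eta : VectorFieldOn R →ₗ[R] R
  nondeg : ∀ Z : VectorFieldOn R, eta Z = 0 → (∀ Y, dForm eta Z Y = 0) → Z = 0
  dim_le : ∀ ω : AlternatingMap R (VectorFieldOn R) R (Fin (2 * n + 2)), ω = 0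
  reeb : VectorFieldOn R
  reeb_eta : eta reeb = 1
  reeb_dEta : ∀ Y, dForm eta reeb Y = 0
  reeb_unique : ∀ Z, eta Z = 1 → (∀ Y, dForm eta Z Y = 0) → Z = reeb
  ham : R → VectorFieldOn R
  ham_eta : ∀ f, eta (ham f) = -f
  ham_dEta : ∀ f Y, dForm eta (ham f) Y = Y f - reeb f * eta Y
  ham_unique : ∀ f Z, eta Z = -f → (∀ Y, dForm eta Z Y = Y f - reeb f * eta Y) → Z = ham f

/-- The Jacobi bracket induced by the contact form: `{f,g}_η = X_f(g) + g R(f)`. -/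
def ExactContact.jacobi {R : Type*} [CommRing R] [Algebra ℝ R]
    (C : ExactContact R) (f g : R) : R :=
  C.ham f g + g * C.reeb f

namespace ExactContact

variable {R : Type*} [CommRing R] [Algebra ℝ R] (C : ExactContact R)

/-- The identity `L_{X_f} η = -R(f) η`, evaluated on a vector field `Y`. -/
theorem eta_lie_ham (f : R) (Y : VectorFieldOn R) :
    C.eta ⁅C.ham f, Y⁆ = C.ham f (C.eta Y) + C.reeb f * C.eta Y := by
  have h := C.ham_dEta f Y
  rw [dForm, C.ham_eta, map_neg] at h
  linear_combination -h

theorem eta_lie_ham_ham (f g : R) : C.eta ⁅C.ham f, C.ham g⁆ = -C.jacobi f g := by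
  rw [eta_lie_ham, ham_eta, map_neg, jacobi]
  ring

theorem eta_lie_lie_ham (f g : R) (Y : VectorFieldOn R) :
    C.eta ⁅⁅C.ham f, C.ham g⁆, Y⁆ = ⁅C.ham f, C.ham g⁆ (C.eta Y) +
      (C.ham f (C.reeb g) - C.ham g (C.reeb f)) * C.eta Y := by
  rw [lie_lie, map_sub]
  simp only [eta_lie_ham, map_add, Derivation.leibniz, smul_eq_mul, Derivation.commutator_apply]
  ring

theorem dForm_lie_ham_ham (f g : R) (Y : VectorFieldOn R) :
    dForm C.eta ⁅C.ham f, C.ham g⁆ Y =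
      Y (C.jacobi f g) - (C.ham f (C.reeb g) - C.ham g (C.reeb f)) * C.eta Y := by
  rw [dForm, eta_lie_lie_ham, eta_lie_ham_ham, map_neg]
  ring

theorem dForm_reeb_right (X : VectorFieldOn R) : dForm C.eta X C.reeb = 0 := by
  have h := C.reeb_dEta X
  rw [dForm, ← lie_skew, map_neg] at h
  rw [dForm]
  linear_combination -h

theorem reeb_jacobi (f g : R) :
    C.reeb (C.jacobi f g) = C.ham f (C.reeb g) - C.ham g (C.reeb f) := by
  have h := C.dForm_lie_ham_ham f g C.reeb
  rw [dForm_reeb_right, reeb_eta] at h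
  linear_combination -h

theorem lie_ham_ham (f g : R) : ⁅C.ham f, C.ham g⁆ = C.ham (C.jacobi f g) :=
  C.ham_unique _ _ (C.eta_lie_ham_ham f g) fun Y => by
    rw [dForm_lie_ham_ham, reeb_jacobi]

theorem eta_lie_ham_right_of_horizontal {δ : VectorFieldOn R} (hδ : C.eta δ = 0) (f : R) :
    C.eta ⁅δ, C.ham f⁆ = 0 := by
  rw [← lie_skew, map_neg, eta_lie_ham, hδ]
  simp

end ExactContact

/-- for `ξ = X_{φ_ξ} + δ_ξ` (with `φ_ξ = -η(ξ)`, `δ_ξ` horizontal),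
`[δ_ξ, X_H]` is horizontal, and `[ξ, X_H] = [X_{φ_ξ}, X_H] + [δ_ξ, X_H]` is the
Hamiltonian–horizontal decomposition of the commutator, with Hamiltonian part
`[X_{φ_ξ}, X_H] = X_{{φ_ξ,H}_η}`. -/
theorem decomposition_of_commutator {R : Type*} [CommRing R] [Algebra ℝ R]
    (C : ExactContact R) (H : R) (ξ : VectorFieldOn R)
    (φ : R) (hφ : φ = -C.eta ξ)
    (δ : VectorFieldOn R) (hδ : δ = ξ - C.ham φ) :
    C.eta ⁅δ, C.ham H⁆ = 0 ∧
      ⁅ξ, C.ham H⁆ = ⁅C.ham φ, C.ham H⁆ + ⁅δ, C.ham H⁆ ∧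
      ⁅C.ham φ, C.ham H⁆ = C.ham (C.jacobi φ H) := by
  refine ⟨C.eta_lie_ham_right_of_horizontal ?_ H, ?_, C.lie_ham_ham φ H⟩
  · rw [hδ, map_sub, C.ham_eta, hφ]
    ring
  · rw [← add_lie, hδ, add_sub_cancel]
end

section
/- Let (M,η,H) be a contact Hamiltonian system and let f, g ∈ C^∞(M) be two dissipated quantities, i.e. {f,H}_η = 0 and {g,H}_η = 0. Then at every point where g ≠ 0 the ratio κ = f/g is conserved along the Hamiltonian flow: X_H(f/g) = 0. -/
open scoped BigOperators

theorem dForm_swap {R : Type*} [CommRing R] [Algebra ℝ R]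
    (η : VectorFieldOn R →ₗ[R] R) (X Y : VectorFieldOn R) :
    dForm η Y X = -dForm η X Y := by
  unfold dForm
  rw [← lie_skew X Y, map_neg]
  ring

namespace ExactContact

variable {R : Type*} [CommRing R] [Algebra ℝ R] (C : ExactContact R)

theorem jacobi_antisymm (f g : R) : C.jacobi g f = -C.jacobi f g := by
  have h := dForm_swap C.eta (C.ham f) (C.ham g)
  simp only [C.ham_dEta, C.ham_eta] at h
  unfold jacobi
  linear_combination h

theorem ham_apply_of_dissipated {H f : R} (hf : C.jacobi f H = 0) :
    C.ham H f = -(f * C.reeb H) := by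
  have h := C.jacobi_antisymm f H
  rw [hf, neg_zero, jacobi] at h
  exact eq_neg_of_add_eq_zero_left h

end ExactContact

/-- if `f` and `g` are dissipated quantities of `(M,η,H)`, then where `g`
is invertible the ratio `κ = f/g` is conserved along the Hamiltonian flow. -/
theorem ratio_of_dissipated_is_conserved {R : Type*} [CommRing R] [Algebra ℝ R]
    (C : ExactContact R) (H f g ginv : R)
    (hf : C.jacobi f H = 0) (hg : C.jacobi g H = 0)
    (hginv : g * ginv = 1) :
    C.ham H (f * ginv) = 0 := by
  have hXf := C.ham_apply_of_dissipated hf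
  have hXg := C.ham_apply_of_dissipated hg
  have hXunit : g * C.ham H ginv + ginv * C.ham H g = 0 := by
    simpa using congrArg (C.ham H) hginv
  have hXginv : C.ham H ginv = ginv * C.reeb H := by
    rw [hXg] at hXunit
    linear_combination ginv * hXunit + (ginv * C.reeb H - C.ham H ginv) * hginv
  rw [Derivation.leibniz, hXf, hXginv, smul_eq_mul, smul_eq_mul]
  ring
end

section
/- Let Y be a dynamical similarity of the contact Hamiltonian system (M,η,H), i.e. [Y, X_H] = λ X_H for some λ ∈ C^∞(M), and let φ_Y = −η(Y). Then at every point where H ≠ 0 one has λ = X_H(−φ_Y/H); that is, the similarity factor λ is the derivative of the function −φ_Y/H along the Hamiltonian flow. -/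
open scoped BigOperators

/-- A contact Hamiltonian is dissipated along its own flow: `X_H(H) = -R(H) H`. -/
theorem ExactContact.ham_apply_self {R : Type*} [CommRing R] [Algebra ℝ R]
    (C : ExactContact R) (H : R) : C.ham H H = -(C.reeb H * H) := by
  have h := C.ham_dEta H (C.ham H)
  simp only [dForm, lie_self, map_zero, sub_self, C.ham_eta] at h
  linear_combination -h

/-- The derivative of `η(Y)` along the Hamiltonian flow of `H`. -/
theorem ExactContact.ham_apply_eta {R : Type*} [CommRing R] [Algebra ℝ R]
    (C : ExactContact R) (H : R) (Y : VectorFieldOn R) :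
    C.ham H (C.eta Y) = -(C.eta ⁅Y, C.ham H⁆) - C.reeb H * C.eta Y := by
  have h := C.ham_dEta H Y
  rw [dForm, C.ham_eta, ← lie_skew, map_neg, map_neg] at h
  linear_combination h

/-- if `Y` is a dynamical similarity of `(M,η,H)`, `[Y,X_H] = λ X_H`,
then where `H` is invertible `λ = X_H(-φ_Y/H)` with `φ_Y = -η(Y)`. -/
theorem dynamical_similarity_factor {R : Type*} [CommRing R] [Algebra ℝ R]
    (C : ExactContact R) (H Hinv : R) (hH : H * Hinv = 1)
    (Y : VectorFieldOn R) (lam : R)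
    (hY : ⁅Y, C.ham H⁆ = lam • C.ham H)
    (φ : R) (hφ : φ = -C.eta Y) :
    lam = C.ham H (-(φ * Hinv)) := by
  have hinv : H * C.ham H Hinv + Hinv * C.ham H H = 0 := by
    simpa only [Derivation.leibniz, smul_eq_mul, Derivation.map_one_eq_zero] using
      congrArg (C.ham H) hH
  have hη := C.ham_apply_eta H Y
  rw [hY, map_smul, C.ham_eta, smul_eq_mul] at hη
  have hself := C.ham_apply_self H
  subst hφ
  rw [neg_mul, neg_neg, Derivation.leibniz, smul_eq_mul, smul_eq_mul]
  linear_combination (-Hinv) * hη - lam * hH - C.eta Y * Hinv * hinv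
    + C.eta Y * Hinv * Hinv * hself + (C.eta Y * C.ham H Hinv - C.eta Y * Hinv * C.reeb H) * hH
end

section
/- Let Y be a scaling symmetry of the contact Hamiltonian system (M,η,H), i.e. [Y, X_H] = λ X_H with λ ∈ ℝ constant, let φ_Y = −η(Y), and suppose f ∈ C^∞(M) is in involution with the Hamiltonian, {f,H}_η = 0. Then the function ψ := {φ_Y, f}_η is also in involution with the Hamiltonian: {ψ, H}_η = 0. -/
open scoped BigOperators

theorem dForm_skew {R : Type*} [CommRing R] [Algebra ℝ R]
    (η : VectorFieldOn R →ₗ[R] R) (X Y : VectorFieldOn R) :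
    dForm η X Y = -dForm η Y X := by
  rw [dForm, dForm, ← lie_skew X Y, map_neg]
  ring

/-- The 1-form `η` is conformally invariant under a contact Hamiltonian vector field:
`L_{X_f} η = -R(f) η`. -/
theorem ExactContact.eta_lie_ham_s18 {R : Type*} [CommRing R] [Algebra ℝ R]
    (C : ExactContact R) (f : R) (Z : VectorFieldOn R) :
    C.eta ⁅C.ham f, Z⁆ = C.ham f (C.eta Z) + C.reeb f * C.eta Z := by
  have h := C.ham_dEta f Z
  rw [dForm, C.ham_eta, map_neg] at h
  linear_combination -h

theorem ExactContact.jacobi_neg_eta {R : Type*} [CommRing R] [Algebra ℝ R]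
    (C : ExactContact R) (f : R) (Z : VectorFieldOn R) :
    C.jacobi f (-C.eta Z) = -C.eta ⁅C.ham f, Z⁆ := by
  rw [C.eta_lie_ham_s18, ExactContact.jacobi, map_neg]
  ring

theorem ExactContact.eta_lie_ham_ham_s18 {R : Type*} [CommRing R] [Algebra ℝ R]
    (C : ExactContact R) (f g : R) :
    C.eta ⁅C.ham f, C.ham g⁆ = -C.jacobi f g := by
  rw [C.eta_lie_ham_s18, C.ham_eta, ExactContact.jacobi, map_neg]
  ring

theorem ExactContact.jacobi_skew {R : Type*} [CommRing R] [Algebra ℝ R]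
    (C : ExactContact R) (f g : R) : C.jacobi f g = -C.jacobi g f := by
  rw [← C.eta_lie_ham_ham_s18 g f, ← lie_skew, map_neg, C.eta_lie_ham_ham_s18, neg_neg]

/-- The map `f ↦ X_f` intertwines the Jacobi bracket and the Lie bracket. -/
theorem ExactContact.lie_ham_ham_s18 {R : Type*} [CommRing R] [Algebra ℝ R]
    (C : ExactContact R) (f g : R) :
    ⁅C.ham f, C.ham g⁆ = C.ham (C.jacobi f g) := by
  have key : ∀ Z, dForm C.eta ⁅C.ham f, C.ham g⁆ Z = Z (C.jacobi f g) +
      (C.ham g (C.reeb f) - C.ham f (C.reeb g)) * C.eta Z := by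
    intro Z
    simp only [dForm, C.eta_lie_ham_ham_s18, lie_lie, map_sub, map_neg, C.eta_lie_ham_s18, map_add,
      Derivation.leibniz, Derivation.commutator_apply, smul_eq_mul]
    ring
  have hR := key C.reeb
  rw [dForm_skew, C.reeb_dEta, C.reeb_eta] at hR
  refine C.ham_unique _ _ (C.eta_lie_ham_ham_s18 f g) fun Z ↦ ?_
  rw [key]
  linear_combination (-C.eta Z) * hR

theorem ExactContact.ham_zero {R : Type*} [CommRing R] [Algebra ℝ R]
    (C : ExactContact R) : C.ham 0 = 0 :=
  (C.ham_unique 0 0 (by simp) (by simp [dForm])).symm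

/-- if `Y` is a scaling symmetry of `(M,η,H)` and `{f,H}_η = 0`, then
`ψ := {φ_Y, f}_η` is also in involution with the Hamiltonian, `{ψ,H}_η = 0`. -/
theorem scaling_symmetry_new_involution {R : Type*} [CommRing R] [Algebra ℝ R]
    (C : ExactContact R) (H f : R) (Y : VectorFieldOn R) (lam : ℝ)
    (hY : ⁅Y, C.ham H⁆ = lam • C.ham H)
    (hf : C.jacobi f H = 0) :
    C.jacobi (C.jacobi (-C.eta Y) f) H = 0 := by
  have hHf : C.jacobi H f = 0 := by rw [C.jacobi_skew, hf, neg_zero]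
  have hψ : C.jacobi (-C.eta Y) f = -C.eta ⁅Y, C.ham f⁆ := by
    rw [C.jacobi_skew, C.jacobi_neg_eta, ← lie_skew Y, map_neg]
  have hYH : ⁅C.ham H, Y⁆ = -(lam • C.ham H) := by rw [← hY, lie_skew]
  rw [C.jacobi_skew, hψ, C.jacobi_neg_eta, leibniz_lie, hYH, neg_lie, smul_lie,
    C.lie_ham_ham_s18, hHf, C.ham_zero]
  simp
end
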